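/- Let K ≥ 1/2 be a real number and let F : ℕ → ℝ be given by F(k) = k(2K+k−1). Then for every n ≥ 0 and every r ∈ ℝ with |r| < π/2, the series ∑_{j=0}^{∞} (−1)^j · (n!/(n+2j)!) · Δ_F(n+1, j) · r^{2j+n} converges (HasSum) with sum (cosh r)^{−2K} (tanh r)^n. -/

import Mathlib

/-- `Delta F m j` is the quantity `Δ_F(m, j)` defined by `Δ_F(m, 0) = 1` and
`Δ_F(m, j) = ∑_{k=1}^{m} F(k) · Δ_F(k+1, j−1)` for `j ≥ 1`. -/
noncomputable def Delta (F : ℕ → ℝ) : ℕ → ℕ → ℝ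
  | _, 0 => 1
  | m, j + 1 => ∑ k ∈ Finset.Icc 1 m, F k * Delta F (k + 1) j
  termination_by m j => j

lemma Delta_succ_right (F : ℕ → ℝ) (m j : ℕ) :
    Delta F m (j + 1) = ∑ k ∈ Finset.Icc 1 m, F k * Delta F (k + 1) j := by
  rw [Delta]

lemma Delta_zero_right (F : ℕ → ℝ) (m : ℕ) : Delta F m 0 = 1 := by
  rw [Delta]

lemma Delta_succ_succ (F : ℕ → ℝ) (m j : ℕ) :
    Delta F (m + 1) (j + 1) = Delta F m (j + 1) + F (m + 1) * Delta F (m + 2) j := by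
  rw [Delta_succ_right, Delta_succ_right, Finset.sum_Icc_succ_top (by omega)]

/-- The hyperbolic cosine has positive real part on the strip `|im z| < π / 2`. -/
lemma Complex.cosh_re_pos_of_abs_im_lt {z : ℂ} (hz : |z.im| < Real.pi / 2) :
    0 < (Complex.cosh z).re := by
  have h : (Complex.cosh z).re = Real.cosh z.re * Real.cos z.im := by
    conv_lhs => rw [← Complex.re_add_im z]
    rw [Complex.cosh_add, Complex.cosh_mul_I, Complex.sinh_mul_I]
    simp [Complex.cos_ofReal_re]
  rw [h]
  exact mul_pos (Real.cosh_pos _) (Real.cos_pos_of_mem_Ioo (abs_lt.mp hz))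

/-- `(cosh z) ^ c * (tanh z) ^ n` as a function of a complex variable. -/
noncomputable def coshPowMulTanhPow (c : ℂ) (n : ℕ) (z : ℂ) : ℂ :=
  Complex.cosh z ^ c * Complex.tanh z ^ n

lemma hasDerivAt_coshPowMulTanhPow (c : ℂ) (n : ℕ) {z : ℂ} (hz : |z.im| < Real.pi / 2) :
    HasDerivAt (coshPowMulTanhPow c n)
      (n * coshPowMulTanhPow c (n - 1) z + (c - n) * coshPowMulTanhPow c (n + 1) z) z := by
  have hre := Complex.cosh_re_pos_of_abs_im_lt hz
  have hne : Complex.cosh z ≠ 0 := fun h => by simp [h] at hre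
  have hpow := (Complex.hasDerivAt_cosh z).cpow_const (c := c) (Or.inl hre)
  have htanh : HasDerivAt Complex.tanh (1 - Complex.tanh z ^ 2) z := by
    have h := (Complex.hasDerivAt_sinh z).div (Complex.hasDerivAt_cosh z) hne
    have heq : Complex.tanh = Complex.sinh / Complex.cosh :=
      funext Complex.tanh_eq_sinh_div_cosh
    rw [heq]
    refine h.congr_deriv ?_
    rw [← heq, Complex.tanh_eq_sinh_div_cosh]
    field_simp
  refine (hpow.mul (htanh.pow n)).congr_deriv ?_
  simp only [coshPowMulTanhPow, Pi.pow_apply]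
  rw [Complex.cpow_sub _ _ hne, Complex.cpow_one]
  have hsinh : Complex.sinh z = Complex.tanh z * Complex.cosh z := by
    rw [Complex.tanh_eq_sinh_div_cosh, div_mul_cancel₀ _ hne]
  rw [hsinh]
  generalize Complex.tanh z = t at *
  rcases n with _ | n
  · field_simp
    simp
  · field_simp
    push_cast
    ring

lemma abs_im_lt_of_mem_ball {z : ℂ} {ρ : ℝ} (hz : z ∈ Metric.ball (0 : ℂ) ρ) : |z.im| < ρ :=
  (Complex.abs_im_le_norm z).trans_lt (by simpa using hz)

lemma differentiableOn_coshPowMulTanhPow (c : ℂ) (n : ℕ) :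
    DifferentiableOn ℂ (coshPowMulTanhPow c n) (Metric.ball 0 (Real.pi / 2)) := fun _ hz =>
  (hasDerivAt_coshPowMulTanhPow c n
    (abs_im_lt_of_mem_ball hz)).differentiableAt.differentiableWithinAt

lemma iteratedDeriv_succ_coshPowMulTanhPow_zero (c : ℂ) (n m : ℕ) :
    iteratedDeriv (m + 1) (coshPowMulTanhPow c n) 0 =
      n * iteratedDeriv m (coshPowMulTanhPow c (n - 1)) 0 +
        (c - n) * iteratedDeriv m (coshPowMulTanhPow c (n + 1)) 0 := by
  have hball : Metric.ball (0 : ℂ) (Real.pi / 2) ∈ nhds 0 :=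
    Metric.ball_mem_nhds _ (by positivity)
  have hcont (k : ℕ) : ContDiffAt ℂ m (coshPowMulTanhPow c k) 0 :=
    ((differentiableOn_coshPowMulTanhPow c k).analyticAt hball).contDiffAt
  have hderiv : deriv (coshPowMulTanhPow c n) =ᶠ[nhds 0]
      (fun z => n * coshPowMulTanhPow c (n - 1) z) +
        fun z => (c - n) * coshPowMulTanhPow c (n + 1) z := by
    filter_upwards [hball] with z hz
    exact (hasDerivAt_coshPowMulTanhPow c n (abs_im_lt_of_mem_ball hz)).deriv
  rw [iteratedDeriv_succ', hderiv.iteratedDeriv_eq,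
    iteratedDeriv_add (contDiffAt_const.mul (hcont _)) (contDiffAt_const.mul (hcont _)),
    iteratedDeriv_const_mul_field, iteratedDeriv_const_mul_field]

lemma coshPowMulTanhPow_zero_right (c : ℂ) (n : ℕ) : coshPowMulTanhPow c n 0 = 0 ^ n := by
  simp [coshPowMulTanhPow]

lemma iteratedDeriv_coshPowMulTanhPow_zero_eq_zero (c : ℂ) {n m : ℕ}
    (h : ∀ j, n + 2 * j ≠ m) : iteratedDeriv m (coshPowMulTanhPow c n) 0 = 0 := by
  induction m generalizing n with
  | zero =>
    have hn : n ≠ 0 := by simpa using h 0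
    simp [coshPowMulTanhPow_zero_right, hn]
  | succ m ih =>
    rw [iteratedDeriv_succ_coshPowMulTanhPow_zero,
      ih (n := n + 1) fun j hj => h (j + 1) (by omega)]
    rcases n with _ | n
    · simp
    · rw [ih (n := n + 1 - 1) fun j hj => h j (by omega)]
      simp

lemma iteratedDeriv_coshPowMulTanhPow_zero (K : ℝ) (n j : ℕ) :
    iteratedDeriv (n + 2 * j) (coshPowMulTanhPow ((-(2 * K) : ℝ) : ℂ) n) 0 =
      (((-1) ^ j * n.factorial *
        Delta (fun k => (k : ℝ) * (2 * K + (k : ℝ) - 1)) (n + 1) j : ℝ) : ℂ) := by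
  obtain ⟨m, hm⟩ : ∃ m, m = n + 2 * j := ⟨_, rfl⟩
  rw [← hm]
  induction m generalizing n j with
  | zero =>
    obtain ⟨rfl, rfl⟩ : n = 0 ∧ j = 0 := by omega
    simp [coshPowMulTanhPow_zero_right, Delta_zero_right]
  | succ m ih =>
    rw [iteratedDeriv_succ_coshPowMulTanhPow_zero]
    rcases j with _ | j
    · obtain ⟨n, rfl⟩ : ∃ k, n = k + 1 := ⟨n - 1, by omega⟩
      rw [Nat.add_sub_cancel, ih n 0 (by omega),
        iteratedDeriv_coshPowMulTanhPow_zero_eq_zero _ fun j => by omega]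
      simp [Delta_zero_right, Nat.factorial_succ]
    · rw [ih (n + 1) j (by omega), Delta_succ_succ]
      rcases n with _ | n
      · rw [Delta_succ_right _ 0]
        simp
        ring
      · rw [Nat.add_sub_cancel, ih n (j + 1) (by omega)]
        push_cast [Nat.factorial_succ]
        ring

/-- In the spin-`K` case `F(k) = k(2K+k−1)` with `K ≥ 1/2`, for `|r| < π/2` the series
`∑_j (−1)^j (n!/(n+2j)!) Δ_F(n+1, j) r^{2j+n}` converges with sum
`(cosh r)^{−2K} (tanh r)^n`. -/
theorem In_spinK (K : ℝ) (hK : 1 / 2 ≤ K) (n : ℕ) (r : ℝ) (hr : |r| < Real.pi / 2) :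
    HasSum
      (fun j : ℕ =>
        (-1 : ℝ) ^ j * ((Nat.factorial n : ℝ) / (Nat.factorial (n + 2 * j) : ℝ)) *
          Delta (fun k => (k : ℝ) * (2 * K + (k : ℝ) - 1)) (n + 1) j * r ^ (2 * j + n))
      (Real.cosh r ^ (-(2 * K)) * Real.tanh r ^ n) := by
  rw [← Complex.hasSum_ofReal]
  have hr' : (r : ℂ) ∈ Metric.ball (0 : ℂ) (Real.pi / 2) := by simpa using hr
  have hsum := Complex.hasSum_taylorSeries_on_ball
    (differentiableOn_coshPowMulTanhPow ((-(2 * K) : ℝ) : ℂ) n) hr'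
  have hinj : Function.Injective fun j : ℕ => n + 2 * j := fun a b h => by
    simp only at h
    omega
  have hval : coshPowMulTanhPow ((-(2 * K) : ℝ) : ℂ) n r =
      ((Real.cosh r ^ (-(2 * K)) * Real.tanh r ^ n : ℝ) : ℂ) := by
    rw [coshPowMulTanhPow, Complex.ofReal_mul, Complex.ofReal_cpow (Real.cosh_pos r).le]
    simp
  rw [hval, ← hinj.hasSum_iff] at hsum
  · refine hsum.congr_fun fun j => ?_
    simp only [Function.comp_apply, iteratedDeriv_coshPowMulTanhPow_zero]
    push_cast
    simp only [smul_eq_mul, sub_zero]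
    ring
  · intro m hm
    rw [iteratedDeriv_coshPowMulTanhPow_zero_eq_zero _ fun j hj => hm ⟨j, hj⟩]
    simp
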